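/- arXiv:1904.04288 — 2 statements merged into one kernel-verified Lean document; each statement's English description precedes it below -/
import Mathlib

section
/- The orthogonal group O₃(𝔽₅), i.e. the group of 3 × 3 matrices A over the field ℤ/5ℤ satisfying A · Aᵀ = I under matrix multiplication, is isomorphic to the direct product of a cyclic group of order 2 and the symmetric group S₅ on 5 letters. -/
open Matrix

/-- The rows of this matrix form an orthonormal basis of a complement of `⟨𝟙⟩` in the hyperplane
`𝟙ᗮ` of `(ZMod 5)⁵`, where `𝟙` is the all-ones vector. -/
def heartBasis : Matrix (Fin 3) (Fin 5) (ZMod 5) :=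
  !![2, 2, -2, -2, 0; 2, -2, 2, -2, 0; 2, -2, -2, 2, 0]

theorem heartBasis_mul_transpose : heartBasis * heartBasisᵀ = 1 := by decide +kernel

theorem heartBasis_row_sum (i : Fin 3) : ∑ k, heartBasis i k = 0 := by
  revert i; decide +kernel

theorem exists_transpose_heartBasis_mul :
    ∃ u : Fin 5 → ZMod 5, ∀ k l, (heartBasisᵀ * heartBasis) k l =
      (1 : Matrix (Fin 5) (Fin 5) (ZMod 5)) k l + u k + u l :=
  ⟨![3, 3, 3, 3, 2], by decide +kernel⟩

/-- The matrix of the action of a permutation on `𝟙ᗮ / ⟨𝟙⟩` with respect to `heartBasis`. -/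
def heartMatrix (σ : Equiv.Perm (Fin 5)) : Matrix (Fin 3) (Fin 3) (ZMod 5) :=
  heartBasis.submatrix id σ * heartBasisᵀ

theorem heartMatrix_one : heartMatrix 1 = 1 := heartBasis_mul_transpose

theorem heartMatrix_mul (σ τ : Equiv.Perm (Fin 5)) :
    heartMatrix (σ * τ) = heartMatrix σ * heartMatrix τ := by
  obtain ⟨u, hu⟩ := exists_transpose_heartBasis_mul
  have key : heartBasis.submatrix id σ * (heartBasisᵀ * heartBasis.submatrix id τ) =
      heartBasis.submatrix id (σ * τ) +
        Matrix.of fun i _ => ∑ k, heartBasis i (σ k) * u k := by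
    ext i l
    have h (k : Fin 5) : (heartBasisᵀ * heartBasis.submatrix id τ) k l =
        (1 : Matrix (Fin 5) (Fin 5) (ZMod 5)) k (τ l) + u k + u (τ l) := hu k (τ l)
    have hσ : ∑ k, heartBasis i (σ k) = 0 :=
      (Equiv.sum_comp σ (heartBasis i)).trans (heartBasis_row_sum i)
    rw [Matrix.mul_apply]
    simp [h, mul_add, Finset.sum_add_distrib, ← Finset.sum_mul, hσ, Matrix.one_apply]
  have h0 : (Matrix.of fun i (_ : Fin 5) => ∑ k, heartBasis i (σ k) * u k) * heartBasisᵀ =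
      (0 : Matrix (Fin 3) (Fin 3) (ZMod 5)) := by
    ext i j
    rw [Matrix.mul_apply]
    simp [← Finset.mul_sum, heartBasis_row_sum]
  calc heartMatrix (σ * τ)
      = (heartBasis.submatrix id σ * (heartBasisᵀ * heartBasis.submatrix id τ)) *
          heartBasisᵀ := by rw [key, Matrix.add_mul, h0, add_zero, heartMatrix]
    _ = heartMatrix σ * heartMatrix τ := by simp only [heartMatrix, Matrix.mul_assoc]

theorem heartMatrix_transpose (σ : Equiv.Perm (Fin 5)) :
    (heartMatrix σ)ᵀ = heartMatrix σ⁻¹ := by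
  ext i j
  simp only [heartMatrix, Matrix.transpose_apply, Matrix.mul_apply, Matrix.submatrix_apply, id]
  rw [← Equiv.sum_comp σ⁻¹]
  simp [mul_comm]

/-- The homomorphism `{±1} × S₅ → O₃(𝔽₅)` sending `(s, σ)` to `s` times the matrix of `σ`. -/
def signedHeartHom : ℤˣ × Equiv.Perm (Fin 5) →* Matrix.orthogonalGroup (Fin 3) (ZMod 5) where
  toFun p := ⟨((p.1 : ℤ) : ZMod 5) • heartMatrix p.2, by
    rw [Matrix.mem_orthogonalGroup_iff, Matrix.transpose_smul, heartMatrix_transpose,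
      smul_mul_smul_comm, ← heartMatrix_mul, mul_inv_cancel, heartMatrix_one, ← Int.cast_mul,
      ← Units.val_mul, Int.units_mul_self, Units.val_one, Int.cast_one, one_smul]⟩
  map_one' := Subtype.ext <| by simp [heartMatrix_one]
  map_mul' p q := Subtype.ext <| by simp [heartMatrix_mul, smul_smul, mul_comm]

theorem signedHeartHom_injective : Function.Injective signedHeartHom := by
  rw [injective_iff_map_eq_one]
  have h : ∀ (s : ℤˣ) (σ : Equiv.Perm (Fin 5)),
      ((s : ℤ) : ZMod 5) • heartMatrix σ = 1 → (s, σ) = 1 := by decide +kernel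
  exact fun p hp => h p.1 p.2 (congrArg Subtype.val hp)

/-- The pairs of orthonormal vectors in `(ZMod 5)³`, with coordinates listed as tuples. -/
@[irreducible]
def orthonormalPairs : Finset
    ((_ : ZMod 5 × ZMod 5 × ZMod 5) × (ZMod 5 × ZMod 5 × ZMod 5)) :=
  (Finset.univ.filter fun v => v.1 * v.1 + v.2.1 * v.2.1 + v.2.2 * v.2.2 = 1).sigma fun v =>
    Finset.univ.filter fun w => w.1 * w.1 + w.2.1 * w.2.1 + w.2.2 * w.2.2 = 1 ∧
      v.1 * w.1 + v.2.1 * w.2.1 + v.2.2 * w.2.2 = 0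

theorem card_orthonormalPairs : orthonormalPairs.card = 120 := by
  rw [orthonormalPairs, Finset.card_sigma]
  decide +kernel

/-- The first two rows and the determinant of a `3 × 3` matrix. -/
def rowsAndDet (A : Matrix (Fin 3) (Fin 3) (ZMod 5)) :
    ((_ : ZMod 5 × ZMod 5 × ZMod 5) × (ZMod 5 × ZMod 5 × ZMod 5)) × ZMod 5 :=
  (⟨(A 0 0, A 0 1, A 0 2), (A 1 0, A 1 1, A 1 2)⟩, A.det)

theorem mul_transpose_eq_one_of_mem {A : Matrix (Fin 3) (Fin 3) (ZMod 5)}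
    (hA : A ∈ Matrix.orthogonalGroup (Fin 3) (ZMod 5)) : A * Aᵀ = 1 :=
  (Matrix.mem_orthogonalGroup_iff _ _).1 hA

theorem det_mul_self_eq_one_of_mem {A : Matrix (Fin 3) (Fin 3) (ZMod 5)}
    (hA : A ∈ Matrix.orthogonalGroup (Fin 3) (ZMod 5)) : A.det * A.det = 1 := by
  simpa using congrArg Matrix.det (mul_transpose_eq_one_of_mem hA)

theorem rowsAndDet_mem {A : Matrix (Fin 3) (Fin 3) (ZMod 5)}
    (hA : A ∈ Matrix.orthogonalGroup (Fin 3) (ZMod 5)) :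
    rowsAndDet A ∈ orthonormalPairs ×ˢ ({1, -1} : Finset (ZMod 5)) := by
  have h := mul_transpose_eq_one_of_mem hA
  have hrow (i j : Fin 3) : A i 0 * A j 0 + A i 1 * A j 1 + A i 2 * A j 2 =
      (1 : Matrix (Fin 3) (Fin 3) (ZMod 5)) i j := by
    rw [← h, Matrix.mul_apply, Fin.sum_univ_three]; rfl
  have : Fact (Nat.Prime 5) := ⟨Nat.prime_five⟩
  simpa [rowsAndDet, orthonormalPairs, hrow] using
    mul_self_eq_one_iff.1 (det_mul_self_eq_one_of_mem hA)

/-- The last row of an orthogonal matrix is the cross product of the first two, up to the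
determinant. -/
theorem rowsAndDet_injOn :
    Set.InjOn rowsAndDet (Matrix.orthogonalGroup (Fin 3) (ZMod 5) : Set _) := by
  have adj {A : Matrix (Fin 3) (Fin 3) (ZMod 5)}
      (hA : A ∈ Matrix.orthogonalGroup (Fin 3) (ZMod 5)) : A.adjugate = A.det • Aᵀ := by
    have h := mul_transpose_eq_one_of_mem hA
    rw [← Matrix.mul_one A.adjugate, ← h, ← Matrix.mul_assoc, Matrix.adjugate_mul,
      Matrix.smul_mul, Matrix.one_mul]
  have last {A : Matrix (Fin 3) (Fin 3) (ZMod 5)}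
      (hA : A ∈ Matrix.orthogonalGroup (Fin 3) (ZMod 5)) (j : Fin 3) :
      A 2 j = A.det * A.adjugate j 2 := by
    rw [adj hA, Matrix.smul_apply, Matrix.transpose_apply, smul_eq_mul, ← mul_assoc,
      det_mul_self_eq_one_of_mem hA, one_mul]
  intro A hA A' hA' h
  simp only [rowsAndDet, Prod.mk.injEq, Sigma.mk.injEq, heq_eq_eq] at h
  obtain ⟨⟨⟨h00, h01, h02⟩, h10, h11, h12⟩, hdet⟩ := h
  have hlast (j : Fin 3) : A 2 j = A' 2 j := by
    rw [last hA, last hA', hdet, Matrix.adjugate_fin_three, Matrix.adjugate_fin_three]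
    fin_cases j <;> simp [h00, h01, h02, h10, h11, h12]
  ext i j
  fin_cases i
  · fin_cases j <;> assumption
  · fin_cases j <;> assumption
  · exact hlast j

theorem card_orthogonalGroup_three_F5_le :
    Nat.card (Matrix.orthogonalGroup (Fin 3) (ZMod 5)) ≤ 240 := by
  have h := Set.ncard_le_ncard_of_injOn rowsAndDet
    (fun _ hA => Finset.mem_coe.2 (rowsAndDet_mem hA)) rowsAndDet_injOn (Finset.finite_toSet _)
  rwa [Set.ncard_coe_finset, Finset.card_product, card_orthonormalPairs,
    Finset.card_pair (by decide)] at h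

/-- The orthogonal group `O₃(𝔽₅)` of `3 × 3` matrices `A` over `ℤ/5ℤ` with
`A * Aᵀ = 1`, under matrix multiplication, is isomorphic to the direct product of a
cyclic group of order 2 and the symmetric group on 5 letters. -/
theorem orthogonalGroup_three_F5_iso :
    Nonempty (Matrix.orthogonalGroup (Fin 3) (ZMod 5) ≃*
      Multiplicative (ZMod 2) × Equiv.Perm (Fin 5)) := by
  have : Fact (Nat.Prime 2) := ⟨Nat.prime_two⟩
  have hS : Nat.card (ℤˣ × Equiv.Perm (Fin 5)) = 240 := by
    rw [Nat.card_prod, Nat.card_perm]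
    simp [Nat.factorial]
  have hbij : Function.Bijective signedHeartHom :=
    signedHeartHom_injective.bijective_of_nat_card_le
      (hS ▸ card_orthogonalGroup_three_F5_le)
  have e : ℤˣ ≃* Multiplicative (ZMod 2) :=
    mulEquivOfPrimeCardEq (p := 2) (by simp) (by simp)
  exact ⟨(MulEquiv.ofBijective signedHeartHom hbij).symm.trans
    (e.prodCongr (MulEquiv.refl _))⟩
end

section
/- Let n ≥ 1 and let b be the ℂ-bilinear form on ℂ^{2+n} given by b(x,y) = x₁y₁ + x₂y₂ − x₃y₃ − ⋯ − x_{2+n}y_{2+n} (the ℂ-bilinear extension of the real symmetric form of signature (2,n)). Then the subset of the complex projective space ℙ(ℂ^{2+n}) consisting of lines [σ] with b(σ,σ) = 0 and b(σ, σ̄) > 0 (where σ̄ denotes coordinatewise complex conjugation, so that b(σ,σ̄) is a real number) has exactly two connected components. -/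
open scoped ComplexConjugate

/-- The quotient topology on the projectivization of a topological vector space. -/
instance projectivizationTopology {K V : Type*} [DivisionRing K] [AddCommGroup V]
    [Module K V] [TopologicalSpace V] : TopologicalSpace (Projectivization K V) :=
  inferInstanceAs (TopologicalSpace (Quotient (projectivizationSetoid K V)))

/-- The `ℂ`-bilinear form `b(x,y) = x₁y₁ + x₂y₂ − x₃y₃ − ⋯ − x_{2+n}y_{2+n}` on
`ℂ^{2+n}`, the `ℂ`-bilinear extension of the real symmetric form of signature `(2,n)`. -/
noncomputable def lorentzB (n : ℕ) (x y : Fin (n + 2) → ℂ) : ℂ :=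
  x 0 * y 0 + x 1 * y 1 -
    ∑ i ∈ Finset.univ.filter (fun i : Fin (n + 2) => 2 ≤ (i : ℕ)), x i * y i

/-- A space split by a clopen set into two nonempty preconnected pieces has exactly two
connected components. -/
theorem card_connectedComponents_eq_two {X : Type*} [TopologicalSpace X] {U : Set X}
    (hU : IsClopen U) (hne : U.Nonempty) (hne' : Uᶜ.Nonempty) (hc : IsPreconnected U)
    (hc' : IsPreconnected Uᶜ) : Nat.card (ConnectedComponents X) = 2 := by
  have hcont : Continuous U.boolIndicator := (continuous_boolIndicator_iff_isClopen U).2 hU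
  rw [← Nat.card_eq_two_iff.2 ⟨true, false, by simp, by ext b; cases b <;> simp⟩]
  refine Nat.card_eq_of_bijective hcont.connectedComponentsLift ⟨?_, ?_⟩
  · intro a b
    obtain ⟨x, rfl⟩ := ConnectedComponents.surjective_coe a
    obtain ⟨y, rfl⟩ := ConnectedComponents.surjective_coe b
    intro h
    simp only [Continuous.connectedComponentsLift_apply_coe] at h
    rw [ConnectedComponents.coe_eq_coe']
    by_cases hy : y ∈ U
    · rw [(U.mem_iff_boolIndicator y).1 hy, ← U.mem_iff_boolIndicator] at h
      exact hc.subset_connectedComponent hy h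
    · rw [(U.notMem_iff_boolIndicator y).1 hy, ← U.notMem_iff_boolIndicator] at h
      exact hc'.subset_connectedComponent hy h
  · rintro (_ | _)
    · obtain ⟨x, hx⟩ := hne'
      exact ⟨x, (U.notMem_iff_boolIndicator x).1 hx⟩
    · obtain ⟨x, hx⟩ := hne
      exact ⟨x, (U.mem_iff_boolIndicator x).1 hx⟩

/-- A set covered by two disjoint open sets, each of which meets it in a connected set, has
exactly two connected components. -/
theorem card_connectedComponents_coe_eq_two {X : Type*} [TopologicalSpace X] {S U V : Set X}
    (hU : IsOpen U) (hV : IsOpen V) (hUV : Disjoint U V) (hS : S ⊆ U ∪ V)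
    (hcU : IsConnected (S ∩ U)) (hcV : IsConnected (S ∩ V)) :
    Nat.card (ConnectedComponents S) = 2 := by
  have hcompl : ((↑) ⁻¹' U : Set S)ᶜ = (↑) ⁻¹' V := by
    ext ⟨x, hx⟩
    simp only [Set.mem_compl_iff, Set.mem_preimage]
    exact ⟨fun h => (hS hx).resolve_left h, fun h h' => Set.disjoint_left.1 hUV h' h⟩
  have hpre : ∀ W : Set X, IsConnected (S ∩ W) → IsConnected ((↑) ⁻¹' W : Set S) := by
    intro W hW
    rw [← Subtype.image_preimage_coe] at hW
    exact ⟨hW.nonempty.of_image, Topology.IsInducing.subtypeVal.isPreconnected_image.1 hW.2⟩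
  refine card_connectedComponents_eq_two (U := ((↑) ⁻¹' U : Set S))
    ⟨⟨?_⟩, hU.preimage continuous_subtype_val⟩ (hpre U hcU).nonempty ?_ (hpre U hcU).2 ?_
  · rw [hcompl]
    exact hV.preimage continuous_subtype_val
  · rw [hcompl]
    exact (hpre V hcV).nonempty
  · rw [hcompl]
    exact (hpre V hcV).2

theorem isQuotientMap_projectivization_mk {K V : Type*} [DivisionRing K] [AddCommGroup V]
    [Module K V] [TopologicalSpace V] :
    Topology.IsQuotientMap fun σ : {v : V // v ≠ 0} => Projectivization.mk K σ.1 σ.2 :=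
  isQuotientMap_quot_mk

/-- The lines on which the isotropic coordinate `x₁ + e x₂` dominates `x₁ - e x₂`, for `e = ± i`. -/
def dominatedLines (n : ℕ) (e : ℂ) : Set (Projectivization ℂ (Fin (n + 2) → ℂ)) :=
  {p | ‖p.rep 0 - e * p.rep 1‖ < ‖p.rep 0 + e * p.rep 1‖}

theorem mk_mem_dominatedLines {n : ℕ} {e : ℂ} {σ : Fin (n + 2) → ℂ} (hσ : σ ≠ 0) :
    Projectivization.mk ℂ σ hσ ∈ dominatedLines n e ↔
      ‖σ 0 - e * σ 1‖ < ‖σ 0 + e * σ 1‖ := by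
  obtain ⟨a, ha⟩ := Projectivization.exists_smul_eq_mk_rep ℂ σ hσ
  have hpos : 0 < ‖(a : ℂ)‖ := norm_pos_iff.2 a.ne_zero
  simp only [dominatedLines, Set.mem_ofPred_eq, ← ha, Pi.smul_apply, Units.smul_def, smul_eq_mul]
  rw [show (a : ℂ) * σ 0 - e * (a * σ 1) = a * (σ 0 - e * σ 1) by ring,
    show (a : ℂ) * σ 0 + e * (a * σ 1) = a * (σ 0 + e * σ 1) by ring, norm_mul, norm_mul,
    mul_lt_mul_iff_right₀ hpos]

theorem isOpen_dominatedLines (n : ℕ) (e : ℂ) : IsOpen (dominatedLines n e) := by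
  rw [← isQuotientMap_projectivization_mk.isOpen_preimage]
  have : (fun σ : {v : Fin (n + 2) → ℂ // v ≠ 0} => Projectivization.mk ℂ σ.1 σ.2) ⁻¹'
      dominatedLines n e = {σ | ‖σ.1 0 - e * σ.1 1‖ < ‖σ.1 0 + e * σ.1 1‖} := by
    ext σ
    exact mk_mem_dominatedLines σ.2
  rw [this]
  have hc (i : Fin (n + 2)) : Continuous fun σ : {v : Fin (n + 2) → ℂ // v ≠ 0} => σ.1 i :=
    (continuous_apply i).comp continuous_subtype_val
  exact isOpen_lt ((hc 0).sub (continuous_const.mul (hc 1))).norm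
    ((hc 0).add (continuous_const.mul (hc 1))).norm

theorem disjoint_dominatedLines_neg (n : ℕ) (e : ℂ) :
    Disjoint (dominatedLines n e) (dominatedLines n (-e)) := by
  rw [Set.disjoint_left]
  intro p h h'
  simp only [dominatedLines, Set.mem_ofPred_eq, neg_mul, sub_neg_eq_add, ← sub_eq_add_neg] at h h'
  exact lt_asymm h h'

theorem lorentzB_self {n : ℕ} {e : ℂ} (he : e * e = -1) (σ : Fin (n + 2) → ℂ) :
    lorentzB n σ σ = (σ 0 + e * σ 1) * (σ 0 - e * σ 1) -
      ∑ i ∈ Finset.univ.filter (fun i : Fin (n + 2) => 2 ≤ (i : ℕ)), σ i * σ i := by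
  unfold lorentzB
  linear_combination (σ 1 * σ 1) * he

theorem re_lorentzB_conj {n : ℕ} {e : ℂ} (he : e * e = -1) (σ : Fin (n + 2) → ℂ) :
    (lorentzB n σ (fun i => conj (σ i))).re =
      (‖σ 0 + e * σ 1‖ ^ 2 + ‖σ 0 - e * σ 1‖ ^ 2) / 2 -
      ∑ i ∈ Finset.univ.filter (fun i : Fin (n + 2) => 2 ≤ (i : ℕ)), ‖σ i‖ ^ 2 := by
  have hnorm : ‖e‖ = 1 := by
    have h : ‖e‖ * ‖e‖ = 1 := by rw [← norm_mul, he]; simp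
    nlinarith [norm_nonneg e]
  have hpar := parallelogram_law_with_norm ℝ (σ 0) (e * σ 1)
  rw [norm_mul, hnorm, one_mul] at hpar
  simp only [lorentzB, Complex.mul_conj, Complex.normSq_eq_norm_sq, Complex.sub_re, Complex.add_re,
    Complex.re_sum, Complex.ofReal_re]
  linarith

/-- The cone of vectors over the period domain. -/
def periodCone (n : ℕ) : Set (Fin (n + 2) → ℂ) :=
  {σ | lorentzB n σ σ = 0 ∧ 0 < (lorentzB n σ (fun i => conj (σ i))).re}

theorem norm_mul_norm_le {n : ℕ} {e : ℂ} (he : e * e = -1) {σ : Fin (n + 2) → ℂ}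
    (hσ : lorentzB n σ σ = 0) :
    ‖σ 0 + e * σ 1‖ * ‖σ 0 - e * σ 1‖ ≤
      ∑ i ∈ Finset.univ.filter (fun i : Fin (n + 2) => 2 ≤ (i : ℕ)), ‖σ i‖ ^ 2 := by
  rw [lorentzB_self he, sub_eq_zero] at hσ
  rw [← norm_mul, hσ]
  refine (norm_sum_le _ _).trans_eq (Finset.sum_congr rfl fun i _ => ?_)
  rw [norm_mul, sq]

theorem norm_ne_of_mem_periodCone {n : ℕ} {e : ℂ} (he : e * e = -1) {σ : Fin (n + 2) → ℂ}
    (hσ : σ ∈ periodCone n) : ‖σ 0 - e * σ 1‖ ≠ ‖σ 0 + e * σ 1‖ := by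
  intro h
  have h1 := norm_mul_norm_le he hσ.1
  have h2 := hσ.2
  rw [re_lorentzB_conj he] at h2
  rw [h] at h1 h2
  nlinarith

/-- The contraction fixing the coordinate `x₁ + e x₂` and scaling `x₁ - e x₂` by `t²` and the
negative definite coordinates by `t`. -/
noncomputable def isotropicContraction {n : ℕ} (e : ℂ) (σ : Fin (n + 2) → ℂ) (t : ℝ) :
    Fin (n + 2) → ℂ := fun i =>
  if i = 0 then ((σ 0 + e * σ 1) + t ^ 2 * (σ 0 - e * σ 1)) / 2
  else if i = 1 then -e * ((σ 0 + e * σ 1) - t ^ 2 * (σ 0 - e * σ 1)) / 2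
  else t * σ i

section isotropicContraction

variable {n : ℕ} {e : ℂ} (σ : Fin (n + 2) → ℂ) (t : ℝ)

theorem isotropicContraction_add (he : e * e = -1) :
    isotropicContraction e σ t 0 + e * isotropicContraction e σ t 1 = σ 0 + e * σ 1 := by
  simp only [isotropicContraction, if_true, one_ne_zero, if_false]
  linear_combination (-((σ 0 + e * σ 1) - t ^ 2 * (σ 0 - e * σ 1)) / 2) * he

theorem isotropicContraction_sub (he : e * e = -1) :
    isotropicContraction e σ t 0 - e * isotropicContraction e σ t 1 =
      t ^ 2 * (σ 0 - e * σ 1) := by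
  simp only [isotropicContraction, if_true, one_ne_zero, if_false]
  linear_combination (((σ 0 + e * σ 1) - t ^ 2 * (σ 0 - e * σ 1)) / 2) * he

theorem isotropicContraction_of_two_le {i : Fin (n + 2)} (hi : 2 ≤ (i : ℕ)) :
    isotropicContraction e σ t i = t * σ i := by
  have h0 : i ≠ 0 := by rintro rfl; simp at hi
  have h1 : i ≠ 1 := by rintro rfl; simp at hi
  simp [isotropicContraction, h0, h1]

theorem isotropicContraction_one (he : e * e = -1) : isotropicContraction e σ 1 = σ := by
  funext i
  by_cases h0 : i = 0
  · subst h0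
    simp only [isotropicContraction, if_true, Complex.ofReal_one]
    ring
  by_cases h1 : i = 1
  · subst h1
    simp only [isotropicContraction, if_true, one_ne_zero, if_false, Complex.ofReal_one]
    linear_combination (-σ 1) * he
  · simp [isotropicContraction, h0, h1]

theorem isotropicContraction_zero :
    isotropicContraction e σ 0 =
      (σ 0 + e * σ 1) • fun i : Fin (n + 2) =>
        if i = 0 then 1 / 2 else if i = 1 then -e / 2 else 0 := by
  funext i
  simp only [isotropicContraction, Complex.ofReal_zero, Pi.smul_apply, smul_eq_mul]
  split_ifs <;> ring

theorem continuous_isotropicContraction : Continuous (isotropicContraction e σ) := by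
  refine continuous_pi fun i => ?_
  unfold isotropicContraction
  split_ifs <;> fun_prop

variable {σ t}

theorem isotropicContraction_mem_periodCone (he : e * e = -1) (hσ : σ ∈ periodCone n)
    (hd : ‖σ 0 - e * σ 1‖ < ‖σ 0 + e * σ 1‖) (ht : t ∈ Set.Icc (0 : ℝ) 1) :
    isotropicContraction e σ t ∈ periodCone n := by
  have hle := norm_mul_norm_le he hσ.1
  obtain ⟨hz, hpos⟩ := hσ
  rw [lorentzB_self he] at hz
  rw [re_lorentzB_conj he] at hpos
  constructor
  · rw [lorentzB_self he, isotropicContraction_add σ t he, isotropicContraction_sub σ t he,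
      Finset.sum_congr rfl fun i hi => by
        rw [isotropicContraction_of_two_le σ t (Finset.mem_filter.1 hi).2,
          show (t * σ i) * (t * σ i) = (t : ℂ) ^ 2 * (σ i * σ i) by ring], ← Finset.mul_sum]
    linear_combination (t : ℂ) ^ 2 * hz
  · rw [re_lorentzB_conj he, isotropicContraction_add σ t he, isotropicContraction_sub σ t he,
      Finset.sum_congr rfl fun i hi => by
        rw [isotropicContraction_of_two_le σ t (Finset.mem_filter.1 hi).2, norm_mul, mul_pow,
          Complex.norm_real, Real.norm_eq_abs, sq_abs], ← Finset.mul_sum, norm_mul, norm_pow,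
      Complex.norm_real, Real.norm_eq_abs, sq_abs]
    have hτ1 : t ^ 2 ≤ 1 := pow_le_one₀ ht.1 ht.2
    have hv := norm_nonneg (σ 0 - e * σ 1)
    generalize ‖σ 0 - e * σ 1‖ = v at *
    generalize ‖σ 0 + e * σ 1‖ = u at *
    generalize ∑ i ∈ Finset.univ.filter (fun i : Fin (n + 2) => 2 ≤ (i : ℕ)), ‖σ i‖ ^ 2 = s at *
    have hτ0 := sq_nonneg t
    generalize t ^ 2 = τ at *
    have hvs : v ^ 2 ≤ s := by nlinarith
    have h1 : 0 ≤ (1 - τ) * (s - v ^ 2) := mul_nonneg (by linarith) (by linarith)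
    have h2 : 0 ≤ (1 - τ) ^ 2 * v ^ 2 := by positivity
    nlinarith

end isotropicContraction

/-- The locus of lines spanned by a vector of `periodCone n`. -/
def periodDomain (n : ℕ) : Set (Projectivization ℂ (Fin (n + 2) → ℂ)) :=
  {p | ∃ (σ : Fin (n + 2) → ℂ) (hσ : σ ≠ 0),
    p = Projectivization.mk ℂ σ hσ ∧ lorentzB n σ σ = 0 ∧
      0 < (lorentzB n σ (fun i => conj (σ i))).re}

theorem isConnected_periodDomain_inter_dominatedLines (n : ℕ) {e : ℂ} (he : e * e = -1) :
    IsConnected (periodDomain n ∩ dominatedLines n e) := by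
  set σ₀ : Fin (n + 2) → ℂ := fun i => if i = 0 then 1 / 2 else if i = 1 then -e / 2 else 0
    with hσ₀_def
  have hadd : σ₀ 0 + e * σ₀ 1 = 1 := by
    simp only [hσ₀_def, if_true, one_ne_zero, if_false]
    linear_combination (-1 / 2) * he
  have hsub : σ₀ 0 - e * σ₀ 1 = 0 := by
    simp only [hσ₀_def, if_true, one_ne_zero, if_false]
    linear_combination (1 / 2) * he
  have htail : ∀ i ∈ Finset.univ.filter (fun i : Fin (n + 2) => 2 ≤ (i : ℕ)), σ₀ i = 0 := by
    intro i hi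
    have hi := (Finset.mem_filter.1 hi).2
    have h0 : i ≠ 0 := by rintro rfl; simp at hi
    have h1 : i ≠ 1 := by rintro rfl; simp at hi
    simp [hσ₀_def, h0, h1]
  have hσ₀ : σ₀ ≠ 0 := by
    intro h
    simp [h] at hadd
  have hmem : Projectivization.mk ℂ σ₀ hσ₀ ∈ periodDomain n ∩ dominatedLines n e := by
    refine ⟨⟨σ₀, hσ₀, rfl, ?_, ?_⟩, ?_⟩
    · rw [lorentzB_self he, hsub, Finset.sum_eq_zero fun i hi => by rw [htail i hi, mul_zero]]
      simp
    · rw [re_lorentzB_conj he, hadd, hsub,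
        Finset.sum_eq_zero fun i hi => by rw [htail i hi, norm_zero, sq, mul_zero]]
      norm_num
    · rw [mk_mem_dominatedLines, hadd, hsub]
      simp
  refine ⟨⟨_, hmem⟩, isPreconnected_of_forall (Projectivization.mk ℂ σ₀ hσ₀) ?_⟩
  rintro _ ⟨⟨σ, hσ, rfl, hcone⟩, hd⟩
  rw [mk_mem_dominatedLines] at hd
  have hu : σ 0 + e * σ 1 ≠ 0 := norm_pos_iff.1 ((norm_nonneg _).trans_lt hd)
  have hne : ∀ t : ℝ, isotropicContraction e σ t ≠ 0 := by
    intro t h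
    apply hu
    rw [← isotropicContraction_add σ t he, h]
    simp
  let γ : ℝ → Projectivization ℂ (Fin (n + 2) → ℂ) := fun t => Projectivization.mk ℂ _ (hne t)
  have hγ : Continuous γ := isQuotientMap_projectivization_mk.continuous.comp
    ((continuous_isotropicContraction σ).subtype_mk hne)
  refine ⟨γ '' Set.Icc 0 1, ?_, ⟨0, by simp, ?_⟩, ⟨1, by simp, ?_⟩,
    isPreconnected_Icc.image γ hγ.continuousOn⟩
  · rintro _ ⟨t, ht, rfl⟩
    refine ⟨⟨_, hne t, rfl, isotropicContraction_mem_periodCone he hcone hd ht⟩, ?_⟩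
    rw [mk_mem_dominatedLines, isotropicContraction_add σ t he, isotropicContraction_sub σ t he,
      norm_mul, norm_pow, Complex.norm_real, Real.norm_eq_abs, sq_abs]
    exact (mul_le_of_le_one_left (norm_nonneg _) (pow_le_one₀ ht.1 ht.2)).trans_lt hd
  · exact (Projectivization.mk_eq_mk_iff' ℂ _ _ _ _).2 ⟨_, (isotropicContraction_zero σ).symm⟩
  · simp only [γ, isotropicContraction_one σ he]

theorem periodDomain_subset_union (n : ℕ) {e : ℂ} (he : e * e = -1) :
    periodDomain n ⊆ dominatedLines n e ∪ dominatedLines n (-e) := by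
  rintro _ ⟨σ, hσ, rfl, hcone⟩
  rw [Set.mem_union, mk_mem_dominatedLines, mk_mem_dominatedLines, neg_mul, sub_neg_eq_add,
    ← sub_eq_add_neg]
  exact lt_or_gt_of_ne (norm_ne_of_mem_periodCone he hcone)

/-- For `n ≥ 1`, the subset of `ℙ(ℂ^{2+n})` of lines `[σ]` with `b(σ,σ) = 0` and
`b(σ,σ̄) > 0` has exactly two connected components. -/
theorem two_components_of_period_domain (n : ℕ) (hn : 1 ≤ n) :
    Nat.card (ConnectedComponents
      {p : Projectivization ℂ (Fin (n + 2) → ℂ) |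
        ∃ (σ : Fin (n + 2) → ℂ) (hσ : σ ≠ 0),
          p = Projectivization.mk ℂ σ hσ ∧ lorentzB n σ σ = 0 ∧
            0 < (lorentzB n σ (fun i => conj (σ i))).re}) = 2 := by
  exact card_connectedComponents_coe_eq_two (isOpen_dominatedLines n Complex.I)
    (isOpen_dominatedLines n (-Complex.I)) (disjoint_dominatedLines_neg n Complex.I)
    (periodDomain_subset_union n Complex.I_mul_I)
    (isConnected_periodDomain_inter_dominatedLines n Complex.I_mul_I)
    (isConnected_periodDomain_inter_dominatedLines n (by simp))
end
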